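/- arXiv:1907.05440 — 4 statements merged into one kernel-verified Lean document; each statement's English description precedes it below -/
import Mathlib

section
/- Let dA ≥ 1, dB ≥ 1, let σ be a state on ℂ^{dB}, and let Φ be the point channel on ℂ^{dB} with fixed state σ. Then for every state ρ on ℂ^{dA} ⊗ ℂ^{dB}, the output (id_{dA} ⊗ Φ)(ρ) equals tr_B(ρ) ⊗ σ (where tr_B is the partial trace over ℂ^{dB}), and in particular (id_{dA} ⊗ Φ)(ρ) is classical-quantum. (Converse direction of Theorem 1(B): point channels on subsystem B are discord-breaking.) -/
open Matrix
open scoped Kronecker ComplexOrder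

noncomputable section

/-- A state: positive semidefinite matrix with unit trace. -/
def IsState {ι : Type} [Fintype ι] (ρ : Matrix ι ι ℂ) : Prop :=
  ρ.PosSemidef ∧ ρ.trace = 1

/-- The rank-one matrix `|ψ⟩⟨ψ| = ψ ψ†`. -/
def outer {d : ℕ} (ψ : Fin d → ℂ) : Matrix (Fin d) (Fin d) ℂ :=
  Matrix.of fun i j => ψ i * star (ψ j)

/-- A bipartite state (on `ℂ^{dA} ⊗ ℂ^{dB}`, Kronecker-product convention) is
classical-quantum with respect to subsystem `A` if it is a convex combination
`∑ k, p k • |ψ k⟩⟨ψ k| ⊗ σB k` with `{ψ k}` orthonormal in `ℂ^{dA}` and `σB k` states. -/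
def IsCQ {dA dB : ℕ} (ρ : Matrix (Fin dA × Fin dB) (Fin dA × Fin dB) ℂ) : Prop :=
  ∃ (n : ℕ) (ψ : Fin n → Fin dA → ℂ) (p : Fin n → ℝ)
    (σB : Fin n → Matrix (Fin dB) (Fin dB) ℂ),
      (∀ k l, star (ψ k) ⬝ᵥ ψ l = if k = l then 1 else 0) ∧
      (∀ k, 0 ≤ p k) ∧ (∑ k, p k = 1) ∧ (∀ k, IsState (σB k)) ∧
      ρ = ∑ k, (p k : ℂ) • (outer (ψ k) ⊗ₖ σB k)

/-- The `(a,b)` block (a matrix on the second factor) of a matrix on `Fin m × ι`. -/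
def blockA {m : ℕ} {ι : Type} (a b : Fin m) :
    Matrix (Fin m × ι) (Fin m × ι) ℂ →ₗ[ℂ] Matrix ι ι ℂ where
  toFun M := Matrix.of fun i j => M (a, i) (b, j)
  map_add' _ _ := rfl
  map_smul' _ _ := rfl

/-- The `(i,j)` slice (a matrix on the first factor) of a matrix on `Fin m × Fin d`. -/
def blockB {m d : ℕ} (i j : Fin d) :
    Matrix (Fin m × Fin d) (Fin m × Fin d) ℂ →ₗ[ℂ] Matrix (Fin m) (Fin m) ℂ where
  toFun M := Matrix.of fun a b => M (a, i) (b, j)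
  map_add' _ _ := rfl
  map_smul' _ _ := rfl

/-- `id_m ⊗ Φ`: the extension of `Φ` (acting on the second factor) by the identity
on the first factor.  On Kronecker products, `(id_m ⊗ Φ)(Y ⊗ₖ X) = Y ⊗ₖ Φ X`. -/
def idTensor {ι : Type} (m : ℕ) (Φ : Matrix ι ι ℂ →ₗ[ℂ] Matrix ι ι ℂ) :
    Matrix (Fin m × ι) (Fin m × ι) ℂ →ₗ[ℂ] Matrix (Fin m × ι) (Fin m × ι) ℂ where
  toFun M := Matrix.of fun p q => Φ (blockA p.1 q.1 M) p.2 q.2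
  map_add' M N := by
    ext ⟨a, i⟩ ⟨b, j⟩
    simp [Matrix.add_apply]
  map_smul' c M := by
    ext ⟨a, i⟩ ⟨b, j⟩
    simp [Matrix.smul_apply]

/-- `Φ ⊗ id_m`: the extension of `Φ` (acting on the first factor) by the identity
on the second factor.  On Kronecker products, `(Φ ⊗ id_m)(X ⊗ₖ Y) = Φ X ⊗ₖ Y`. -/
def tensorId {d : ℕ} (Φ : Matrix (Fin d) (Fin d) ℂ →ₗ[ℂ] Matrix (Fin d) (Fin d) ℂ)
    (m : ℕ) :
    Matrix (Fin d × Fin m) (Fin d × Fin m) ℂ →ₗ[ℂ]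
      Matrix (Fin d × Fin m) (Fin d × Fin m) ℂ where
  toFun M := Matrix.of fun p q => Φ (blockB p.2 q.2 M) p.1 q.1
  map_add' M N := by
    ext ⟨a, i⟩ ⟨b, j⟩
    simp [Matrix.add_apply]
  map_smul' c M := by
    ext ⟨a, i⟩ ⟨b, j⟩
    simp [Matrix.smul_apply]

/-- CPTP: trace preserving and completely positive (every extension `id_k ⊗ Φ`
maps positive semidefinite matrices to positive semidefinite matrices). -/
def IsCPTP {ι : Type} [Fintype ι] (Φ : Matrix ι ι ℂ →ₗ[ℂ] Matrix ι ι ℂ) : Prop :=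
  (∀ X, (Φ X).trace = X.trace) ∧
  ∀ k : ℕ, ∀ M : Matrix (Fin k × ι) (Fin k × ι) ℂ,
    M.PosSemidef → (idTensor k Φ M).PosSemidef

/-- Partial trace over the second (B) factor: `tr_B(X ⊗ₖ Y) = tr(Y) • X`. -/
def ptraceB {dA dB : ℕ} (M : Matrix (Fin dA × Fin dB) (Fin dA × Fin dB) ℂ) :
    Matrix (Fin dA) (Fin dA) ℂ :=
  Matrix.of fun a b => ∑ i, M (a, i) (b, i)

/-- The point channel with fixed state `σ`: `X ↦ tr(X) • σ`. -/
def pointChannel {d : ℕ} (σ : Matrix (Fin d) (Fin d) ℂ) :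
    Matrix (Fin d) (Fin d) ℂ →ₗ[ℂ] Matrix (Fin d) (Fin d) ℂ where
  toFun X := X.trace • σ
  map_add' X Y := by simp [Matrix.trace_add, add_smul]
  map_smul' c X := by simp [Matrix.trace_smul, smul_smul]

/-- A quantum-classical channel: `Φ(X) = ∑ k, tr(F k * X) • |ψ k⟩⟨ψ k|` for an
orthonormal family `{ψ k}` and a POVM `{F k}`. -/
def IsQCChannel {d : ℕ} (Φ : Matrix (Fin d) (Fin d) ℂ →ₗ[ℂ] Matrix (Fin d) (Fin d) ℂ) :
    Prop :=
  ∃ (n : ℕ) (ψ : Fin n → Fin d → ℂ) (F : Fin n → Matrix (Fin d) (Fin d) ℂ),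
    (∀ k l, star (ψ k) ⬝ᵥ ψ l = if k = l then 1 else 0) ∧
    (∀ k, (F k).PosSemidef) ∧ (∑ k, F k = 1) ∧
    (∀ X, Φ X = ∑ k, (F k * X).trace • outer (ψ k))

/-- The partial trace of a positive semidefinite matrix is positive semidefinite. -/
theorem Matrix.PosSemidef.ptraceB {dA dB : ℕ}
    {M : Matrix (Fin dA × Fin dB) (Fin dA × Fin dB) ℂ} (hM : M.PosSemidef) :
    (ptraceB M).PosSemidef := by
  have h : _root_.ptraceB M = ∑ i, M.submatrix (fun a => (a, i)) (fun a => (a, i)) := by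
    ext a b
    simp [_root_.ptraceB, Matrix.sum_apply]
  rw [h]
  exact Matrix.posSemidef_sum _ fun i _ => hM.submatrix _

/-- The partial trace preserves the trace. -/
theorem trace_ptraceB {dA dB : ℕ} (M : Matrix (Fin dA × Fin dB) (Fin dA × Fin dB) ℂ) :
    (ptraceB M).trace = M.trace := by
  simp [ptraceB, Matrix.trace, Fintype.sum_prod_type]

/-- The partial trace of a state is a state. -/
theorem IsState.ptraceB {dA dB : ℕ} {ρ : Matrix (Fin dA × Fin dB) (Fin dA × Fin dB) ℂ}
    (hρ : IsState ρ) : IsState (ptraceB ρ) :=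
  ⟨hρ.1.ptraceB, (trace_ptraceB ρ).trans hρ.2⟩

/-- A Hermitian matrix is the sum of its eigenprojections weighted by its eigenvalues. -/
theorem Matrix.IsHermitian.eq_sum_eigenvalues_smul_outer {d : ℕ}
    {A : Matrix (Fin d) (Fin d) ℂ} (hA : A.IsHermitian) :
    A = ∑ k, (hA.eigenvalues k : ℂ) • outer (hA.eigenvectorBasis k).ofLp := by
  conv_lhs => rw [hA.spectral_theorem]
  ext i j
  rw [Unitary.conjStarAlgAut_apply, Matrix.mul_apply, Matrix.sum_apply]
  refine Finset.sum_congr rfl fun k _ => ?_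
  rw [Matrix.mul_diagonal]
  simp [outer]
  ring

/-- The product of two states is classical-quantum. -/
theorem IsState.isCQ_kronecker {dA dB : ℕ} {τ : Matrix (Fin dA) (Fin dA) ℂ}
    {σ : Matrix (Fin dB) (Fin dB) ℂ} (hτ : IsState τ) (hσ : IsState σ) :
    IsCQ (τ ⊗ₖ σ) := by
  have hH := hτ.1.isHermitian
  refine ⟨dA, fun k => (hH.eigenvectorBasis k).ofLp, hH.eigenvalues, fun _ => σ, ?_,
    hτ.1.eigenvalues_nonneg, ?_, fun _ => hσ, ?_⟩
  · intro k l
    have h := orthonormal_iff_ite.mp hH.eigenvectorBasis.orthonormal k l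
    rw [EuclideanSpace.inner_eq_star_dotProduct, dotProduct_comm] at h
    exact h
  · have h := hH.trace_eq_sum_eigenvalues
    rw [hτ.2] at h
    exact Complex.ofReal_injective (by simpa using h.symm)
  · conv_lhs => rw [hH.eq_sum_eigenvalues_smul_outer]
    ext ⟨a, i⟩ ⟨b, j⟩
    simp [Matrix.sum_apply, Finset.sum_mul, mul_assoc]

/-- A point channel on the second factor replaces that factor by its fixed state. -/
theorem idTensor_pointChannel {dA dB : ℕ} (σ : Matrix (Fin dB) (Fin dB) ℂ)
    (M : Matrix (Fin dA × Fin dB) (Fin dA × Fin dB) ℂ) :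
    idTensor dA (pointChannel σ) M = ptraceB M ⊗ₖ σ := by
  ext ⟨a, i⟩ ⟨b, j⟩
  rfl

/-- point channels on subsystem `B` produce product (hence
classical-quantum) states. -/
theorem stmt_0 (dA dB : ℕ) (hdA : 1 ≤ dA) (hdB : 1 ≤ dB)
    (σ : Matrix (Fin dB) (Fin dB) ℂ) (hσ : IsState σ)
    (ρ : Matrix (Fin dA × Fin dB) (Fin dA × Fin dB) ℂ) (hρ : IsState ρ) :
    idTensor dA (pointChannel σ) ρ = ptraceB ρ ⊗ₖ σ ∧
      IsCQ (idTensor dA (pointChannel σ) ρ) := by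
  rw [idTensor_pointChannel]
  exact ⟨rfl, hρ.ptraceB.isCQ_kronecker hσ⟩
end
end

section
/- Let dB ≥ 1 and let Φ be a CPTP map on dB×dB complex matrices such that for every dA ≥ 2 and every state ρ on ℂ^{dA} ⊗ ℂ^{dB}, the output (id_{dA} ⊗ Φ)(ρ) is classical-quantum with respect to subsystem A. Then Φ is a point channel: there exists a state σ on ℂ^{dB} such that Φ(X) = tr(X)·σ for every dB×dB matrix X. (Forward direction of Theorem 1(B): a channel acting on subsystem B is discord-breaking if and only if it is a fixed-point channel.) -/
open Matrix
open scoped Kronecker ComplexOrder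

noncomputable section

theorem blockB_kronecker {m d : ℕ} (A : Matrix (Fin m) (Fin m) ℂ)
    (X : Matrix (Fin d) (Fin d) ℂ) (i j : Fin d) : blockB i j (A ⊗ₖ X) = X i j • A := by
  ext a b
  exact mul_comm _ _

theorem outer_mul_outer {d : ℕ} (φ ψ : Fin d → ℂ) :
    outer φ * outer ψ = (star φ ⬝ᵥ ψ) • vecMulVec φ (star ψ) := by
  ext a b
  simp only [outer, Matrix.mul_apply, Matrix.of_apply, Matrix.smul_apply, vecMulVec_apply,
    dotProduct, smul_eq_mul, Pi.star_apply, Finset.sum_mul]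
  exact Finset.sum_congr rfl fun _ _ => by ring

/-- The slices of a classical-quantum state along the second factor are simultaneously
diagonal, hence commute. -/
theorem IsCQ.commute_blockB {dA dB : ℕ} {ρ : Matrix (Fin dA × Fin dB) (Fin dA × Fin dB) ℂ}
    (h : IsCQ ρ) (i j k l : Fin dB) : Commute (blockB i j ρ) (blockB k l ρ) := by
  obtain ⟨n, ψ, p, σ, hψ, -, -, -, rfl⟩ := h
  have hblock (i j : Fin dB) : blockB i j (∑ k, (p k : ℂ) • (outer (ψ k) ⊗ₖ σ k)) =
      ∑ k, ((p k : ℂ) * σ k i j) • outer (ψ k) := by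
    simp only [map_sum, map_smul, blockB_kronecker, smul_smul]
  rw [hblock, hblock]
  refine Commute.sum_left _ _ _ fun s _ => Commute.sum_right _ _ _ fun t _ => ?_
  refine Commute.smul_left (Commute.smul_right ?_ _) _
  by_cases hst : s = t
  · subst hst
    exact Commute.refl _
  · rw [commute_iff_eq, outer_mul_outer, outer_mul_outer, hψ, hψ, if_neg hst,
      if_neg (Ne.symm hst), zero_smul, zero_smul]

theorem idTensor_kronecker {ι : Type} (m : ℕ) (Φ : Matrix ι ι ℂ →ₗ[ℂ] Matrix ι ι ℂ)
    (A : Matrix (Fin m) (Fin m) ℂ) (X : Matrix ι ι ℂ) :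
    idTensor m Φ (A ⊗ₖ X) = A ⊗ₖ Φ X := by
  ext ⟨a, i⟩ ⟨b, j⟩
  have h : blockA a b (A ⊗ₖ X) = A a b • X := rfl
  simp [idTensor, h]

theorem IsCPTP.posSemidef {ι : Type} [Fintype ι] {Φ : Matrix ι ι ℂ →ₗ[ℂ] Matrix ι ι ℂ}
    (hΦ : IsCPTP Φ) {X : Matrix ι ι ℂ} (hX : X.PosSemidef) : (Φ X).PosSemidef := by
  have h := hΦ.2 1 _ ((PosSemidef.one (n := Fin 1) (R := ℂ)).kronecker hX)
  rw [idTensor_kronecker] at h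
  convert h.submatrix (fun i : ι => ((0 : Fin 1), i)) using 1
  ext i j
  simp

/-- If the output of `id ⊗ Φ` is classical-quantum on states of a qubit and `B`, then the
channel `Φ` takes the same value on all states. -/
theorem eq_of_isCQ {d : ℕ}
    {Φ : Matrix (Fin d) (Fin d) ℂ →ₗ[ℂ] Matrix (Fin d) (Fin d) ℂ}
    (htr : ∀ X, (Φ X).trace = X.trace)
    (hCQ : ∀ ρ : Matrix (Fin 2 × Fin d) (Fin 2 × Fin d) ℂ, IsState ρ → IsCQ (idTensor 2 Φ ρ))
    {X Y : Matrix (Fin d) (Fin d) ℂ} (hX : IsState X) (hY : IsState Y) : Φ X = Φ Y := by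
  obtain ⟨P, hP, hP'⟩ : ∃ P : Matrix (Fin 2) (Fin 2) ℂ, P.PosSemidef ∧ P = !![1, 0; 0, 0] :=
    ⟨_, posSemidef_vecMulVec_self_star ![1, 0], by
      ext i j; fin_cases i <;> fin_cases j <;> simp [vecMulVec_apply]⟩
  obtain ⟨Q, hQ, hQ'⟩ : ∃ Q : Matrix (Fin 2) (Fin 2) ℂ, Q.PosSemidef ∧ Q = !![1, 1; 1, 1] :=
    ⟨_, posSemidef_vecMulVec_self_star ![1, 1], by
      ext i j; fin_cases i <;> fin_cases j <;> simp [vecMulVec_apply]⟩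
  set c : ℂ := 3⁻¹ with hc
  have hc0 : 0 ≤ c := by rw [hc]; positivity
  have hρ : IsState (c • (P ⊗ₖ X + Q ⊗ₖ Y)) := by
    refine ⟨((hP.kronecker hX.1).add (hQ.kronecker hY.1)).smul hc0, ?_⟩
    rw [trace_smul, trace_add, trace_kronecker, trace_kronecker, hX.2, hY.2, hP', hQ']
    norm_num [hc, trace_fin_two]
  have hcomm := (hCQ _ hρ).commute_blockB
  simp only [map_smul, map_add, idTensor_kronecker, blockB_kronecker] at hcomm
  ext i j
  have hentry (k : Fin d) : Φ X i j * Φ Y k k = Φ Y i j * Φ X k k := by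
    have h := congrFun (congrFun (hcomm i j k k).eq 0) 1
    simp [hP', hQ', hc, Matrix.mul_apply] at h
    linear_combination 9 * h
  have hsum := Finset.sum_congr (rfl : (Finset.univ : Finset (Fin d)) = _) fun k _ => hentry k
  rw [← Finset.mul_sum, ← Finset.mul_sum] at hsum
  have hXt : ∑ k, Φ X k k = 1 := (htr X).trans hX.2
  have hYt : ∑ k, Φ Y k k = 1 := (htr Y).trans hY.2
  rwa [hXt, hYt, mul_one, mul_one] at hsum

/-- By polarization, a linear map vanishing on rank-one positive semidefinite matrices is zero. -/
theorem eq_zero_of_forall_vecMulVec_self_star {d : ℕ} {V : Type*} [AddCommGroup V] [Module ℂ V]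
    (L : Matrix (Fin d) (Fin d) ℂ →ₗ[ℂ] V)
    (hL : ∀ v : Fin d → ℂ, L (vecMulVec v (star v)) = 0) : L = 0 := by
  have hpol (x y : Fin d → ℂ) : L (vecMulVec x (star y)) = 0 := by
    have h : vecMulVec x (star y) = (4⁻¹ : ℂ) • (vecMulVec (x + y) (star (x + y))
        - vecMulVec (x - y) (star (x - y))
        + Complex.I • vecMulVec (x + Complex.I • y) (star (x + Complex.I • y))
        - Complex.I • vecMulVec (x - Complex.I • y) (star (x - Complex.I • y))) := by
      ext a b
      simp [vecMulVec_apply]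
      ring_nf
      simp
      ring
    rw [h]
    simp only [map_smul, map_sub, map_add, hL]
    simp
  refine Matrix.ext_linearMap _ fun i j => LinearMap.ext_ring ?_
  have h := hpol (Pi.single i 1) (Pi.single j 1)
  rwa [← Pi.single_star, star_one, ← single_eq_single_vecMulVec_single] at h

/-- a CPTP map on `B` that is discord-breaking (type B) must be a
point channel. -/
theorem stmt_1 (dB : ℕ) (hdB : 1 ≤ dB)
    (Φ : Matrix (Fin dB) (Fin dB) ℂ →ₗ[ℂ] Matrix (Fin dB) (Fin dB) ℂ)
    (hΦ : IsCPTP Φ)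
    (hDB : ∀ dA : ℕ, 2 ≤ dA →
      ∀ ρ : Matrix (Fin dA × Fin dB) (Fin dA × Fin dB) ℂ, IsState ρ →
        IsCQ (idTensor dA Φ ρ)) :
    ∃ σ : Matrix (Fin dB) (Fin dB) ℂ, IsState σ ∧ ∀ X, Φ X = X.trace • σ := by
  have hd : (dB : ℂ) ≠ 0 := by exact_mod_cast Nat.one_le_iff_ne_zero.mp hdB
  have hτ : IsState ((dB : ℂ)⁻¹ • (1 : Matrix (Fin dB) (Fin dB) ℂ)) :=
    ⟨PosSemidef.one.smul (by positivity), by simp [hd]⟩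
  set τ : Matrix (Fin dB) (Fin dB) ℂ := (dB : ℂ)⁻¹ • 1
  refine ⟨Φ τ, ⟨hΦ.posSemidef hτ.1, (hΦ.1 τ).trans hτ.2⟩, fun X => ?_⟩
  suffices h : Φ - pointChannel (Φ τ) = 0 from LinearMap.congr_fun (sub_eq_zero.mp h) X
  refine eq_zero_of_forall_vecMulVec_self_star _ fun v => sub_eq_zero.mpr ?_
  have hv : (vecMulVec v (star v)).PosSemidef := posSemidef_vecMulVec_self_star v
  set Y := vecMulVec v (star v)
  change Φ Y = Y.trace • Φ τ
  by_cases ht : Y.trace = 0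
  · rw [ht, zero_smul, hv.trace_eq_zero_iff.mp ht, map_zero]
  · have hY : IsState (Y.trace⁻¹ • Y) :=
      ⟨hv.smul (inv_nonneg.mpr hv.trace_nonneg), by simp [ht]⟩
    rw [← eq_of_isCQ hΦ.1 (hDB 2 le_rfl) hY hτ, map_smul, smul_inv_smul₀ ht]
end
end

section
/- Let dA ≥ 2 and let Φ be a CPTP map on dA×dA complex matrices such that for every dB ≥ 2 and every state ρ on ℂ^{dA} ⊗ ℂ^{dB}, the output (Φ ⊗ id_{dB})(ρ) is classical-quantum with respect to subsystem A. Then Φ is a quantum-classical channel: there exist an orthonormal family {|k⟩} in ℂ^{dA} and a POVM {F_k} such that Φ(X) = Σ_k tr(F_k X)·|k⟩⟨k| for all X. (Forward direction of Theorem 1(A).) -/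
open Matrix
open scoped Kronecker ComplexOrder

noncomputable section

/-- The maximally entangled state on `ℂ^d ⊗ ℂ^d`. -/
def maxEntangled (d : ℕ) : Matrix (Fin d × Fin d) (Fin d × Fin d) ℂ :=
  ((d : ℝ)⁻¹ : ℂ) • vecMulVec (fun x => if x.1 = x.2 then (1 : ℂ) else 0)
    (star fun x => if x.1 = x.2 then (1 : ℂ) else 0)

theorem isState_maxEntangled {d : ℕ} (hd : d ≠ 0) : IsState (maxEntangled d) := by
  have hd' : (d : ℂ) ≠ 0 := by exact_mod_cast hd
  refine ⟨(posSemidef_vecMulVec_self_star _).smul ?_, ?_⟩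
  · exact_mod_cast inv_nonneg.2 (Nat.cast_nonneg (α := ℝ) d)
  · simp [maxEntangled, Matrix.trace, vecMulVec_apply, Fintype.sum_prod_type, hd']

theorem blockB_maxEntangled {d : ℕ} (i j : Fin d) :
    blockB i j (maxEntangled d) = ((d : ℝ)⁻¹ : ℂ) • Matrix.single i j (1 : ℂ) := by
  ext a b
  change maxEntangled d (a, i) (b, j) = _
  simp only [maxEntangled, Matrix.smul_apply, vecMulVec_apply, Pi.star_apply,
    Matrix.single_apply]
  by_cases h : i = a <;> by_cases h' : j = b <;> simp [h, h', Ne.symm]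

theorem trace_outer {d : ℕ} (ψ : Fin d → ℂ) : (outer ψ).trace = star ψ ⬝ᵥ ψ := by
  simp [outer, Matrix.trace, dotProduct, mul_comm]

theorem map_eq_sum_single {d : ℕ}
    (Φ : Matrix (Fin d) (Fin d) ℂ →ₗ[ℂ] Matrix (Fin d) (Fin d) ℂ)
    (X : Matrix (Fin d) (Fin d) ℂ) :
    Φ X = ∑ i, ∑ j, X i j • Φ (Matrix.single i j 1) := by
  conv_lhs => rw [Matrix.matrix_eq_sum_single X]
  simp only [map_sum, ← map_smul, Matrix.smul_single, smul_eq_mul, mul_one]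

/-- a CPTP map on `A` that is discord-breaking (type A) must be a
quantum-classical channel. -/
theorem stmt_3 (dA : ℕ) (hdA : 2 ≤ dA)
    (Φ : Matrix (Fin dA) (Fin dA) ℂ →ₗ[ℂ] Matrix (Fin dA) (Fin dA) ℂ)
    (hΦ : IsCPTP Φ)
    (hDB : ∀ dB : ℕ, 2 ≤ dB →
      ∀ ρ : Matrix (Fin dA × Fin dB) (Fin dA × Fin dB) ℂ, IsState ρ →
        IsCQ (tensorId Φ dB ρ)) :
    IsQCChannel Φ := by
  have hd : dA ≠ 0 := by lia
  have hdR : (dA : ℂ) ≠ 0 := by exact_mod_cast hd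
  obtain ⟨n, ψ, p, σ, hψ, hp, -, hσ, hρ⟩ := hDB dA hdA _ (isState_maxEntangled hd)
  let F : Fin n → Matrix (Fin dA) (Fin dA) ℂ := fun k => ((dA * p k : ℝ) : ℂ) • (σ k)ᵀ
  have hsingle (i j : Fin dA) :
      Φ (Matrix.single i j 1) = ∑ k, F k j i • outer (ψ k) := by
    ext a b
    have h := congrFun (congrFun hρ (a, i)) (b, j)
    simp only [tensorId, LinearMap.coe_mk, AddHom.coe_mk, Matrix.of_apply,
      blockB_maxEntangled, map_smul, Matrix.smul_apply, Matrix.sum_apply,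
      kroneckerMap_apply, smul_eq_mul, Complex.ofReal_natCast] at h
    rw [inv_mul_eq_iff_eq_mul₀ hdR] at h
    rw [h, Finset.mul_sum, Matrix.sum_apply]
    refine Finset.sum_congr rfl fun k _ => ?_
    simp only [F, Matrix.smul_apply, Matrix.transpose_apply, smul_eq_mul]
    push_cast
    ring
  refine ⟨n, ψ, F, hψ, fun k => ?_, ?_, fun X => ?_⟩
  · refine (hσ k).1.transpose.smul ?_
    exact_mod_cast mul_nonneg (Nat.cast_nonneg (α := ℝ) dA) (hp k)
  · ext j i
    have h := hΦ.1 (Matrix.single i j 1)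
    rw [hsingle, Matrix.trace_sum] at h
    simp only [Matrix.trace_smul, trace_outer, hψ, if_true, smul_eq_mul, mul_one] at h
    rw [Matrix.sum_apply, h]
    by_cases hij : i = j
    · subst hij; simp
    · simp [Matrix.trace_single_eq_of_ne, hij, Ne.symm hij]
  · simp only [map_eq_sum_single Φ X, hsingle, Matrix.trace, Matrix.diag_apply,
      Matrix.mul_apply, Finset.sum_smul, Finset.smul_sum, smul_smul]
    rw [Finset.sum_comm, Finset.sum_comm (s := (Finset.univ : Finset (Fin n)))]
    refine Finset.sum_congr rfl fun j _ => ?_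
    rw [Finset.sum_comm (s := (Finset.univ : Finset (Fin n)))]
    simp only [mul_comm]
end
end

section
/- The set of discord-annihilating channels is not convex: there exist two CPTP maps Φ₁ and Φ₂ on 4×4 complex matrices (the matrices on ℂ² ⊗ ℂ²), each discord-annihilating (i.e., Φᵢ(ρ) is classical-quantum with respect to the first subsystem for every state ρ on ℂ² ⊗ ℂ²), such that the convex combination Φ = (1/2)Φ₁ + (1/2)Φ₂ is a CPTP map that is not discord-annihilating: there exists a state ρ on ℂ² ⊗ ℂ² with Φ(ρ) not classical-quantum. (Lemma 4.) -/
open Matrix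
open scoped Kronecker ComplexOrder

noncomputable section

theorem blockA_apply {m : ℕ} {ι : Type} (a b : Fin m) (M : Matrix (Fin m × ι) (Fin m × ι) ℂ)
    (i j : ι) : blockA a b M i j = M (a, i) (b, j) := rfl

theorem blockB_apply {m d : ℕ} (i j : Fin d) (M : Matrix (Fin m × Fin d) (Fin m × Fin d) ℂ)
    (a b : Fin m) : blockB i j M a b = M (a, i) (b, j) := rfl

theorem idTensor_apply {ι : Type} (m : ℕ) (Φ : Matrix ι ι ℂ →ₗ[ℂ] Matrix ι ι ℂ)
    (M : Matrix (Fin m × ι) (Fin m × ι) ℂ) (p q : Fin m × ι) :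
    idTensor m Φ M p q = Φ (blockA p.1 q.1 M) p.2 q.2 := rfl

/-- The channel `X ↦ tr(X) • σ` preparing the fixed state `σ`. -/
def replacementChannel {ι : Type} [Fintype ι] (σ : Matrix ι ι ℂ) :
    Matrix ι ι ℂ →ₗ[ℂ] Matrix ι ι ℂ :=
  (Matrix.traceLinearMap ι ℂ ℂ).smulRight σ

theorem replacementChannel_apply {ι : Type} [Fintype ι] (σ X : Matrix ι ι ℂ) :
    replacementChannel σ X = X.trace • σ := rfl

theorem IsState.isCPTP_replacementChannel {ι : Type} [Fintype ι] {σ : Matrix ι ι ℂ}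
    (hσ : IsState σ) : IsCPTP (replacementChannel σ) := by
  classical
  refine ⟨fun X => by simp [replacementChannel_apply, Matrix.trace_smul, hσ.2], fun k M hM => ?_⟩
  have hsum : (∑ i : ι, M.submatrix (fun a : Fin k => (a, i)) (fun a => (a, i))).PosSemidef :=
    Matrix.posSemidef_sum _ fun i _ => hM.submatrix _
  have hM' : idTensor k (replacementChannel σ) M =
      (∑ i : ι, M.submatrix (fun a : Fin k => (a, i)) (fun a => (a, i))) ⊗ₖ σ := by
    ext ⟨a, i⟩ ⟨b, j⟩
    simp [idTensor_apply, replacementChannel_apply, blockA_apply, Matrix.trace, Matrix.sum_apply]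
  rw [hM']
  exact hsum.kronecker hσ.1

theorem smul_replacementChannel_add {ι : Type} [Fintype ι] (a b : ℂ) (σ τ : Matrix ι ι ℂ) :
    a • replacementChannel σ + b • replacementChannel τ =
      replacementChannel (a • σ + b • τ) := by
  ext1 X
  simp only [LinearMap.add_apply, LinearMap.smul_apply, replacementChannel_apply, smul_add]
  rw [smul_comm a, smul_comm b]

theorem IsState.half_add_half {ι : Type} [Fintype ι] {σ τ : Matrix ι ι ℂ}
    (hσ : IsState σ) (hτ : IsState τ) : IsState ((1 / 2 : ℂ) • σ + (1 / 2 : ℂ) • τ) := by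
  have h : (0 : ℂ) ≤ 1 / 2 := by positivity
  refine ⟨(hσ.1.smul h).add (hτ.1.smul h), ?_⟩
  rw [Matrix.trace_add, Matrix.trace_smul, Matrix.trace_smul, hσ.2, hτ.2]
  norm_num

theorem outer_eq_vecMulVec {d : ℕ} (ψ : Fin d → ℂ) : outer ψ = vecMulVec ψ (star ψ) := rfl

theorem isState_outer {d : ℕ} {ψ : Fin d → ℂ} (hψ : star ψ ⬝ᵥ ψ = 1) : IsState (outer ψ) := by
  rw [outer_eq_vecMulVec]
  exact ⟨Matrix.posSemidef_vecMulVec_self_star ψ,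
    by rw [Matrix.trace_vecMulVec, dotProduct_comm, hψ]⟩

theorem IsState.kronecker {ι κ : Type} [Fintype ι] [Fintype κ] {σ : Matrix ι ι ℂ}
    {τ : Matrix κ κ ℂ} (hσ : IsState σ) (hτ : IsState τ) : IsState (σ ⊗ₖ τ) := by
  classical
  exact ⟨hσ.1.kronecker hτ.1, by rw [Matrix.trace_kronecker, hσ.2, hτ.2, one_mul]⟩

theorem isCQ_outer_kronecker {dA dB : ℕ} {ψ : Fin dA → ℂ} (hψ : star ψ ⬝ᵥ ψ = 1)
    {τ : Matrix (Fin dB) (Fin dB) ℂ} (hτ : IsState τ) : IsCQ (outer ψ ⊗ₖ τ) :=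
  ⟨1, fun _ => ψ, fun _ => 1, fun _ => τ,
    fun k l => by rw [hψ, if_pos (Subsingleton.elim k l)], by simp, by simp, fun _ => hτ, by simp⟩

theorem star_dotProduct_three_fifths_four_fifths :
    star ![(3 / 5 : ℂ), 4 / 5] ⬝ᵥ ![3 / 5, 4 / 5] = 1 := by
  norm_num [dotProduct, Fin.sum_univ_two, map_ofNat]

/-- An equal mixture of non-commuting pure states on the first factor, flagged by orthogonal
states on the second factor, is not classical-quantum. -/
theorem not_isCQ_flagged_mixture :
    ¬ IsCQ ((1 / 2 : ℂ) • (outer ![(1 : ℂ), 0] ⊗ₖ outer ![(1 : ℂ), 0]) +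
      (1 / 2 : ℂ) • (outer ![(3 / 5 : ℂ), 4 / 5] ⊗ₖ outer ![(0 : ℂ), 1])) := by
  intro h
  have h01 := congrFun (congrFun (h.commute_blockB 0 0 1 1).eq 0) 1
  norm_num [blockB_apply, outer, Matrix.mul_apply, Fin.sum_univ_two, map_ofNat] at h01

/-- Lemma 4: the set of discord-annihilating channels is not
convex. -/
theorem stmt_14 :
    ∃ Φ₁ Φ₂ : Matrix (Fin 2 × Fin 2) (Fin 2 × Fin 2) ℂ →ₗ[ℂ]
        Matrix (Fin 2 × Fin 2) (Fin 2 × Fin 2) ℂ,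
      IsCPTP Φ₁ ∧ IsCPTP Φ₂ ∧
      (∀ ρ : Matrix (Fin 2 × Fin 2) (Fin 2 × Fin 2) ℂ, IsState ρ →
        IsCQ (Φ₁ ρ) ∧ IsCQ (Φ₂ ρ)) ∧
      IsCPTP ((1 / 2 : ℂ) • Φ₁ + (1 / 2 : ℂ) • Φ₂) ∧
      ∃ ρ : Matrix (Fin 2 × Fin 2) (Fin 2 × Fin 2) ℂ, IsState ρ ∧
        ¬ IsCQ (((1 / 2 : ℂ) • Φ₁ + (1 / 2 : ℂ) • Φ₂) ρ) := by
  have he₀ : star ![(1 : ℂ), 0] ⬝ᵥ ![1, 0] = 1 := by simp [dotProduct, Fin.sum_univ_two]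
  have he₁ : star ![(0 : ℂ), 1] ⬝ᵥ ![0, 1] = 1 := by simp [dotProduct, Fin.sum_univ_two]
  have hv := star_dotProduct_three_fifths_four_fifths
  have h₁ := (isState_outer he₀).kronecker (isState_outer he₀)
  have h₂ := (isState_outer hv).kronecker (isState_outer he₁)
  refine ⟨replacementChannel _, replacementChannel _, h₁.isCPTP_replacementChannel,
    h₂.isCPTP_replacementChannel, fun ρ hρ => ?_, ?_, _, h₁, ?_⟩
  · rw [replacementChannel_apply, replacementChannel_apply, hρ.2, one_smul, one_smul]
    exact ⟨isCQ_outer_kronecker he₀ (isState_outer he₀),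
      isCQ_outer_kronecker hv (isState_outer he₁)⟩
  · rw [smul_replacementChannel_add]
    exact (h₁.half_add_half h₂).isCPTP_replacementChannel
  · rw [smul_replacementChannel_add, replacementChannel_apply, h₁.2, one_smul]
    exact not_isCQ_flagged_mixture
end
end
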